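/- For every labeled tree T with n ≥ 1 edges, each of whose edges is labeled by a single symbol of a weighted alphabet Γ, there exists an SLP G over Γ defining all nonempty prefixes in T such that: (a) G has at most 4n variables and every right-hand side of G has length at most 6; and (b) the subgraph of dag(G) induced by the set of heavy symbols of G is a disjoint union of paths. -/

import Mathlib

/-- A straight-line program: every variable has exactly one rule `rhs A`,
and a ranking witnesses acyclicity (variables on right-hand sides have
smaller rank), so every variable derives a unique string `val A`. -/
structure SLP (V : Type) (Γ : Type) where
  rhs : V → List (V ⊕ Γ)
  rank : V → ℕ
  rank_lt : ∀ A B, Sum.inl B ∈ rhs A → rank B < rank A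
  start : V

namespace SLP

variable {V Γ : Type}

/-- The string derived by a variable. -/
def val (G : SLP V Γ) (A : V) : List Γ :=
  ((G.rhs A).attach.map (fun β =>
    match β with
    | ⟨Sum.inl B, _⟩ => G.val B
    | ⟨Sum.inr a, _⟩ => [a])).flatten
termination_by G.rank A
decreasing_by exact G.rank_lt _ _ (by assumption)

/-- A string is defined by the SLP if some variable derives it. -/
def defines (G : SLP V Γ) (s : List Γ) : Prop := ∃ A, G.val A = s

/-- The size of an SLP: total length of all right-hand sides. -/
def size [Fintype V] (G : SLP V Γ) : ℕ := ∑ A : V, (G.rhs A).length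

end SLP

/-- Weight of a string over a weighted alphabet. -/
def wstr {Γ : Type} (w : Γ → ℕ) (s : List Γ) : ℕ := (s.map w).sum

namespace SLP

variable {V Γ : Type}

/-- Weight of the string derived by a variable. -/
def wval (G : SLP V Γ) (w : Γ → ℕ) (A : V) : ℕ := wstr w (G.val A)

/-- Weight of a symbol (variable or terminal). -/
def symWeight (G : SLP V Γ) (w : Γ → ℕ) : V ⊕ Γ → ℕ
  | Sum.inl B => G.wval w B
  | Sum.inr a => w a

/-- An SLP is contracting (w.r.t. the weight `w`) if every variable `B` on the
right-hand side of a rule of `A` satisfies `‖B‖ ≤ ‖A‖/2`. -/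
def Contracting (G : SLP V Γ) (w : Γ → ℕ) : Prop :=
  ∀ A B, Sum.inl B ∈ G.rhs A → 2 * G.wval w B ≤ G.wval w A

end SLP


/-- Weight of a string of symbols (variables or terminals). -/
def SLP.swstr {V Γ : Type} (G : SLP V Γ) (w : Γ → ℕ) (s : List (V ⊕ Γ)) : ℕ :=
  (s.map (G.symWeight w)).sum

/-- `β` is a heavy child of `A`: `β` occurs on the right-hand side of the rule of
`A` and `‖β‖ > ‖rhs A‖ / 2`. -/
def SLP.HeavyChild {V Γ : Type} (G : SLP V Γ) (w : Γ → ℕ) (A : V) (β : V ⊕ Γ) : Prop :=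
  β ∈ G.rhs A ∧ G.swstr w (G.rhs A) < 2 * G.symWeight w β

/-- A heavy symbol: a symbol that is the heavy child of some variable. -/
def SLP.HeavySym {V Γ : Type} (G : SLP V Γ) (w : Γ → ℕ) (β : V ⊕ Γ) : Prop :=
  ∃ A : V, G.HeavyChild w A β

/-- A labeled rooted tree: each non-root node `v` has a parent, and the edge from
the parent to `v` is labeled by the string `label v`; a depth function witnesses
well-foundedness of the parent relation. -/
structure LTree (ν Γ : Type) where
  root : ν
  parent : ν → Option ν
  label : ν → List Γ
  depth : ν → ℕ
  parent_eq_none : ∀ v, parent v = none ↔ v = root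
  depth_lt : ∀ v u, parent v = some u → depth u < depth v

namespace LTree

variable {ν Γ : Type}

/-- The prefix in `T` at node `v`: the concatenation of the edge labels along the
path from the root to `v`. -/
def prefixAt (T : LTree ν Γ) (v : ν) : List Γ :=
  match h : T.parent v with
  | none => []
  | some u => T.prefixAt u ++ T.label v
termination_by T.depth v
decreasing_by exact T.depth_lt v u h

/-- A node is a leaf if it has no children. -/
def IsLeaf (T : LTree ν Γ) (v : ν) : Prop := ∀ u, T.parent u ≠ some v

/-- A caterpillar tree: every node has at most one child that is not a leaf. -/
def Caterpillar (T : LTree ν Γ) : Prop :=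
  ∀ u v₁ v₂, T.parent v₁ = some u → T.parent v₂ = some u →
    ¬T.IsLeaf v₁ → ¬T.IsLeaf v₂ → v₁ = v₂

end LTree

theorem wstr_append {Γ : Type} (w : Γ → ℕ) (s t : List Γ) :
    wstr w (s ++ t) = wstr w s + wstr w t := by
  simp [wstr]

theorem wstr_flatten {Γ : Type} (w : Γ → ℕ) (L : List (List Γ)) :
    wstr w L.flatten = (L.map (wstr w)).sum := by
  induction L with
  | nil => rfl
  | cons a L ih => simp [wstr_append, ih]

theorem wstr_pos {Γ : Type} {w : Γ → ℕ} (hw : ∀ a, 0 < w a) {s : List Γ} (hs : s ≠ []) :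
    0 < wstr w s := by
  cases s with
  | nil => exact absurd rfl hs
  | cons a s =>
    have := hw a
    simp [wstr]
    omega

namespace SLP

variable {V Γ : Type}

/-- The string derived by a symbol. -/
def symVal (G : SLP V Γ) : V ⊕ Γ → List Γ
  | Sum.inl B => G.val B
  | Sum.inr a => [a]

theorem val_eq (G : SLP V Γ) (A : V) : G.val A = ((G.rhs A).map G.symVal).flatten := by
  rw [SLP.val]
  congr 1
  conv_rhs => rw [← List.attach_map_subtype_val (G.rhs A), List.map_map]
  apply List.map_congr_left
  rintro ⟨β, hβ⟩ _
  cases β <;> rfl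

theorem symWeight_eq (G : SLP V Γ) (w : Γ → ℕ) (β : V ⊕ Γ) :
    G.symWeight w β = wstr w (G.symVal β) := by
  cases β <;> simp [symWeight, symVal, wval, wstr]

theorem swstr_rhs (G : SLP V Γ) (w : Γ → ℕ) (A : V) :
    G.swstr w (G.rhs A) = G.wval w A := by
  rw [swstr, wval, val_eq, wstr_flatten, List.map_map]
  congr 1
  apply List.map_congr_left
  intro β _
  exact G.symWeight_eq w β

theorem Contracting.not_heavySym {G : SLP V Γ} {w : Γ → ℕ} (h : G.Contracting w) (B : V) :
    ¬ G.HeavySym w (Sum.inl B) := by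
  rintro ⟨A, hA, hlt⟩
  have := h A B hA
  rw [swstr_rhs] at hlt
  simp only [symWeight] at hlt
  omega

end SLP

/-- `x` is a concatenation of at most `k` strings, each of which has length at most one or
belongs to `F` and has weight at most `W / 2`. -/
def Dec {Γ : Type} (w : Γ → ℕ) (F : Set (List Γ)) (k W : ℕ) (x : List Γ) : Prop :=
  ∃ L : List (List Γ), L.length ≤ k ∧ L.flatten = x ∧
    ∀ p ∈ L, p.length ≤ 1 ∨ (p ∈ F ∧ 2 * wstr w p ≤ W)

namespace Dec

variable {Γ : Type} {w : Γ → ℕ} {F : Set (List Γ)} {k l W W' : ℕ} {x y : List Γ}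

theorem append (hx : Dec w F k W x) (hy : Dec w F l W y) : Dec w F (k + l) W (x ++ y) := by
  obtain ⟨L, h1, h2, h3⟩ := hx
  obtain ⟨M, g1, g2, g3⟩ := hy
  refine ⟨L ++ M, by simp; omega, by simp [h2, g2], ?_⟩
  intro p hp
  rcases List.mem_append.1 hp with hp | hp
  · exact h3 p hp
  · exact g3 p hp

theorem mono (hx : Dec w F k W x) (hk : k ≤ l) (hW : W ≤ W') : Dec w F l W' x := by
  obtain ⟨L, h1, h2, h3⟩ := hx
  refine ⟨L, by omega, h2, fun p hp => ?_⟩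
  rcases h3 p hp with h | ⟨h, h'⟩
  · exact Or.inl h
  · exact Or.inr ⟨h, by omega⟩

theorem single (h : x.length ≤ 1 ∨ x ∈ F) (hW : 2 * wstr w x ≤ W) : Dec w F 1 W x := by
  refine ⟨[x], by simp, by simp, fun p hp => ?_⟩
  obtain rfl : p = x := by simpa using hp
  exact h.imp_right fun h => ⟨h, hW⟩

theorem letter (a : Γ) : Dec w F 1 W [a] :=
  ⟨[[a]], by simp, by simp, fun p hp => Or.inl (by simp_all)⟩

end Dec

/-- A finite family of strings closed under decomposition is the set of strings derived by the
variables of a contracting SLP. -/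
theorem exists_contracting_slp {Γ : Type} {w : Γ → ℕ} (hw : ∀ a, 0 < w a)
    (F : Finset (List Γ)) (hne : F.Nonempty)
    (hF : ∀ x ∈ F, Dec w (F : Set (List Γ)) 6 (wstr w x) x) :
    ∃ G : SLP {x // x ∈ F} Γ, (∀ A, G.val A = A.1) ∧ (∀ A, (G.rhs A).length ≤ 6) ∧
      G.Contracting w := by
  classical
  choose! L hlen hflat hmem using hF
  let sym (x p : List Γ) : List ({x // x ∈ F} ⊕ Γ) :=
    if h : p ∈ F ∧ 1 < p.length ∧ 2 * wstr w p ≤ wstr w x then [Sum.inl ⟨p, h.1⟩]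
    else p.map Sum.inr
  have hsym : ∀ x p B, Sum.inl B ∈ sym x p → 0 < wstr w B.1 ∧ 2 * wstr w B.1 ≤ wstr w x := by
    intro x p B hB
    by_cases h : p ∈ F ∧ 1 < p.length ∧ 2 * wstr w p ≤ wstr w x
    · simp only [sym, dif_pos h, List.mem_singleton, Sum.inl.injEq] at hB
      subst hB
      refine ⟨wstr_pos hw ?_, h.2.2⟩
      rintro rfl
      simp at h
    · simp [sym, dif_neg h] at hB
  let rhs (A : {x // x ∈ F}) : List ({x // x ∈ F} ⊕ Γ) := (L A.1).flatMap (sym A.1)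
  have hrhs : ∀ A B, Sum.inl B ∈ rhs A → 0 < wstr w B.1 ∧ 2 * wstr w B.1 ≤ wstr w A.1 := by
    intro A B hB
    obtain ⟨p, _, hp⟩ := List.mem_flatMap.1 hB
    exact hsym _ _ _ hp
  let G : SLP {x // x ∈ F} Γ :=
    { rhs := rhs
      rank := fun A => wstr w A.1
      rank_lt := fun A B hB => by
        have := hrhs A B hB
        omega
      start := ⟨hne.choose, hne.choose_spec⟩ }
  have hval : ∀ A, G.val A = A.1 := by
    intro A
    induction hm : wstr w A.1 using Nat.strong_induction_on generalizing A with
    | _ m ihm =>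
      rw [G.val_eq]
      have key : ∀ p ∈ L A.1, ((sym A.1 p).map G.symVal).flatten = p := by
        intro p hp
        by_cases h : p ∈ F ∧ 1 < p.length ∧ 2 * wstr w p ≤ wstr w A.1
        · have h1 : 0 < wstr w p := (hsym A.1 p ⟨p, h.1⟩ (by simp [sym, dif_pos h])).1
          have h2 := h.2.2
          have := ihm (wstr w p) (by omega) ⟨p, h.1⟩ rfl
          simp [sym, dif_pos h, SLP.symVal, this]
        · simp only [sym, dif_neg h, List.map_map]
          induction p with
          | nil => rfl
          | cons a p ih => simp [Function.comp_def, SLP.symVal, ← List.flatMap_def]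
      conv_rhs => rw [← hflat A.1 A.2]
      change (((L A.1).flatMap (sym A.1)).map G.symVal).flatten = _
      generalize L A.1 = M at key
      induction M with
      | nil => rfl
      | cons p M ih =>
        simp only [List.flatMap_cons, List.map_append, List.flatten_append, List.flatten_cons]
        rw [key p (by simp), ih fun q hq => key q (by simp [hq])]
  refine ⟨G, hval, ?_, ?_⟩
  · intro A
    have hs : ∀ p ∈ L A.1, (sym A.1 p).length ≤ 1 := by
      intro p hp
      by_cases h : p ∈ F ∧ 1 < p.length ∧ 2 * wstr w p ≤ wstr w A.1
      · simp [sym, dif_pos h]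
      · simp only [sym, dif_neg h, List.length_map]
        rcases hmem A.1 A.2 p hp with h' | ⟨h1, h2⟩
        · exact h'
        · by_contra h'
          exact h ⟨h1, by omega, h2⟩
    have h6 := hlen A.1 A.2
    refine le_trans ?_ h6
    change ((L A.1).flatMap (sym A.1)).length ≤ _
    generalize L A.1 = M at hs
    clear h6
    induction M with
    | nil => simp
    | cons p M ih =>
      have h1 := hs p (by simp)
      have h2 := ih fun q hq => hs q (by simp [hq])
      simp only [List.flatMap_cons, List.length_append, List.length_cons]
      omega
  · intro A B hB
    simp only [SLP.wval, hval]
    exact (hrhs A B hB).2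

/-- A nonempty list has an element such that the parts before and after it weigh at most half of
the total. -/
theorem List.exists_balanced_split {α : Type} (f : α → ℕ) {l : List α} (hl : l ≠ []) :
    ∃ L b R, l = L ++ b :: R ∧ 2 * (L.map f).sum ≤ (l.map f).sum ∧
      2 * (R.map f).sum ≤ (l.map f).sum := by
  have key : ∀ (l : List α) (c S : ℕ), l ≠ [] → 2 * c ≤ S → S ≤ 2 * (c + (l.map f).sum) →
      ∃ L b R, l = L ++ b :: R ∧ 2 * (c + (L.map f).sum) ≤ S ∧
        S ≤ 2 * (c + (L.map f).sum + f b) := by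
    intro l
    induction l with
    | nil => intro c S h; exact absurd rfl h
    | cons x xs ih =>
      intro c S _ h1 h2
      by_cases hx : S ≤ 2 * (c + f x)
      · exact ⟨[], x, xs, rfl, by simpa using h1, by simpa using hx⟩
      · simp only [List.map_cons, List.sum_cons] at h2
        have hxs : xs ≠ [] := by
          rintro rfl
          simp at h2
          omega
        obtain ⟨L, b, R, rfl, h3, h4⟩ := ih (c + f x) S hxs (by omega) (by omega)
        refine ⟨x :: L, b, R, rfl, ?_, ?_⟩ <;> simp only [List.map_cons, List.sum_cons] <;> omega
  obtain ⟨L, b, R, h, h1, h2⟩ := key l 0 (l.map f).sum hl (by omega) (by omega)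
  refine ⟨L, b, R, h, by simpa using h1, ?_⟩
  have : (l.map f).sum = (L.map f).sum + (f b + (R.map f).sum) := by simp [h]
  omega

/-- The concatenation of a list of blocks can be split around single blocks, down to
single blocks, using fewer intermediate strings than there are blocks. -/
theorem exists_split_family {Γ : Type} (w : Γ → ℕ) (Bs : List (List Γ)) :
    ∃ E : Finset (List Γ), E.card ≤ Bs.length - 1 ∧
      (Bs.flatten = [] ∨ Bs.flatten ∈ Bs ∨ Bs.flatten ∈ E) ∧
      ∀ x ∈ E, ∃ A b C, x = A ++ (b ++ C) ∧ b ∈ Bs ∧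
        2 * wstr w A ≤ wstr w x ∧ 2 * wstr w C ≤ wstr w x ∧
        (A = [] ∨ A ∈ Bs ∨ A ∈ E) ∧ (C = [] ∨ C ∈ Bs ∨ C ∈ E) := by
  classical
  induction hm : Bs.length using Nat.strong_induction_on generalizing Bs with
  | _ m ih =>
    by_cases h1 : Bs.length ≤ 1
    · refine ⟨∅, by simp, ?_, by simp⟩
      match Bs, h1 with
      | [], _ => simp
      | [b], _ => simp
    · have hne : Bs ≠ [] := by
        rintro rfl
        simp at h1
      obtain ⟨L, b, R, hB, hL, hR⟩ := List.exists_balanced_split (wstr w) hne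
      simp only [← wstr_flatten] at hL hR
      have hlen : Bs.length = L.length + (R.length + 1) := by simp [hB]
      obtain ⟨E₁, c₁, a₁, e₁⟩ := ih L.length (by omega) L rfl
      obtain ⟨E₂, c₂, a₂, e₂⟩ := ih R.length (by omega) R rfl
      have upL : ∀ y, (y = [] ∨ y ∈ L ∨ y ∈ E₁) →
          (y = [] ∨ y ∈ Bs ∨ y ∈ insert Bs.flatten (E₁ ∪ E₂)) := by
        rintro y (h | h | h)
        · exact Or.inl h
        · exact Or.inr (Or.inl (by simp [hB, h]))
        · exact Or.inr (Or.inr (by simp [h]))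
      have upR : ∀ y, (y = [] ∨ y ∈ R ∨ y ∈ E₂) →
          (y = [] ∨ y ∈ Bs ∨ y ∈ insert Bs.flatten (E₁ ∪ E₂)) := by
        rintro y (h | h | h)
        · exact Or.inl h
        · exact Or.inr (Or.inl (by simp [hB, h]))
        · exact Or.inr (Or.inr (by simp [h]))
      refine ⟨insert Bs.flatten (E₁ ∪ E₂), ?_, Or.inr (Or.inr (by simp)), ?_⟩
      · have := Finset.card_insert_le Bs.flatten (E₁ ∪ E₂)
        have := Finset.card_union_le E₁ E₂
        omega
      · intro x hx
        rcases Finset.mem_insert.1 hx with rfl | hx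
        · exact ⟨L.flatten, b, R.flatten, by simp [hB], by simp [hB], hL, hR,
            upL _ a₁, upR _ a₂⟩
        · rcases Finset.mem_union.1 hx with hx | hx
          · obtain ⟨A, b', C, h, hb, h1, h2, h3, h4⟩ := e₁ x hx
            exact ⟨A, b', C, h, by simp [hB, hb], h1, h2, upL _ h3, upL _ h4⟩
          · obtain ⟨A, b', C, h, hb, h1, h2, h3, h4⟩ := e₂ x hx
            exact ⟨A, b', C, h, by simp [hB, hb], h1, h2, upR _ h3, upR _ h4⟩

section Blocks

variable {Γ : Type}

/-- The suffix of length `2 ^ i` of a string (the whole string if it is too short). -/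
def lastBlock (i : ℕ) (s : List Γ) : List Γ := s.drop (s.length - 2 ^ i)

theorem length_lastBlock_zero (s : List Γ) : (lastBlock 0 s).length ≤ 1 := by
  simp [lastBlock]
  omega

/-- The blocks of level less than `i` that end at aligned positions inside `s`. -/
def IsBlock (K i : ℕ) (s y : List Γ) : Prop :=
  ∃ s' i', s' ≠ [] ∧ s' <+: s ∧ i' < i ∧ 2 ^ i' ∣ s'.length + K ∧ y = lastBlock i' s'

theorem IsBlock.mono {K i j : ℕ} {s t y : List Γ} (h : IsBlock K i s y) (hij : i ≤ j)
    (hst : s <+: t) : IsBlock K j t y := by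
  obtain ⟨s', i', h1, h2, h3, h4⟩ := h
  exact ⟨s', i', h1, h2.trans hst, by omega, h4⟩

/-- The parts of a block around one of its letters are concatenations of smaller blocks. -/
theorem exists_blocks_around (K i : ℕ) {s A B : List Γ} {e : Γ} (hs : s ≠ [])
    (hi : 2 ^ i ∣ s.length + K) (h : lastBlock i s = A ++ e :: B) :
    ∃ LA LB : List (List Γ), A = LA.flatten ∧ B = LB.flatten ∧ LA.length + LB.length ≤ i ∧
      (∀ y ∈ LA, IsBlock K i s y) ∧ ∀ y ∈ LB, IsBlock K i s y := by
  induction i generalizing s A B with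
  | zero =>
    have h1 := length_lastBlock_zero s
    rw [h] at h1
    simp only [List.length_append, List.length_cons] at h1
    have hA : A = [] := List.eq_nil_of_length_eq_zero (by omega)
    have hB : B = [] := List.eq_nil_of_length_eq_zero (by omega)
    exact ⟨[], [], by simp [hA], by simp [hB], by simp, by simp, by simp⟩
  | succ i ih =>
    have hi' : 2 ^ i ∣ s.length + K := (pow_dvd_pow 2 (Nat.le_succ i)).trans hi
    by_cases hlen : s.length ≤ 2 ^ i
    · have : lastBlock i s = lastBlock (i + 1) s := by
        simp only [lastBlock]
        congr 1
        rw [pow_succ]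
        omega
      obtain ⟨LA, LB, h1, h2, h3, h4, h5⟩ := ih hs hi' (this.trans h)
      exact ⟨LA, LB, h1, h2, by omega, fun y hy => (h4 y hy).mono (by omega) (List.prefix_refl s),
        fun y hy => (h5 y hy).mono (by omega) (List.prefix_refl s)⟩
    · have hlen' : (s.take (s.length - 2 ^ i)).length = s.length - 2 ^ i := by simp
      have hs' : s.take (s.length - 2 ^ i) ≠ [] := by
        intro h0
        rw [h0, List.length_nil] at hlen'
        omega
      have hpre : s.take (s.length - 2 ^ i) <+: s := ⟨_, List.take_append_drop _ _⟩
      have hdvd : 2 ^ i ∣ (s.take (s.length - 2 ^ i)).length + K := by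
        rw [hlen', show s.length - 2 ^ i + K = s.length + K - 2 ^ i by omega]
        exact Nat.dvd_sub hi' (dvd_refl _)
      have hsplit : lastBlock (i + 1) s =
          lastBlock i (s.take (s.length - 2 ^ i)) ++ lastBlock i s := by
        simp only [lastBlock, hlen']
        conv_lhs => rw [← List.take_append_drop (s.length - 2 ^ i) s]
        rw [List.drop_append_of_le_length]
        · congr 2
          simp
          rw [pow_succ]
          omega
        · simp
          rw [pow_succ]
          omega
      have b1 : IsBlock K (i + 1) s (lastBlock i s) :=
        ⟨s, i, hs, List.prefix_refl s, by omega, hi', rfl⟩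
      have b2 : IsBlock K (i + 1) s (lastBlock i (s.take (s.length - 2 ^ i))) :=
        ⟨_, i, hs', hpre, by omega, hdvd, rfl⟩
      rw [hsplit, List.append_eq_append_iff] at h
      rcases h with ⟨A', rfl, hA'⟩ | ⟨B', hB', hB''⟩
      · obtain ⟨LA, LB, h1, h2, h3, h4, h5⟩ := ih hs hi' hA'
        refine ⟨lastBlock i (s.take (s.length - 2 ^ i)) :: LA, LB, by simp [h1], h2,
          by simp; omega, ?_, fun y hy => (h5 y hy).mono (by omega) (List.prefix_refl s)⟩
        intro y hy
        rcases List.mem_cons.1 hy with rfl | hy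
        · exact b2
        · exact (h4 y hy).mono (by omega) (List.prefix_refl s)
      · rcases B' with _ | ⟨e', B'⟩
        · simp only [List.nil_append] at hB''
          obtain ⟨LA, LB, h1, h2, h3, h4, h5⟩ := ih (A := []) hs hi' hB''.symm
          refine ⟨[lastBlock i (s.take (s.length - 2 ^ i))], LB, by simpa using hB'.symm, h2,
            by simp; omega, by simpa using b2,
            fun y hy => (h5 y hy).mono (by omega) (List.prefix_refl s)⟩
        · simp only [List.cons_append, List.cons.injEq] at hB''
          obtain ⟨rfl, rfl⟩ := hB''
          obtain ⟨LA, LB, h1, h2, h3, h4, h5⟩ := ih hs' hdvd hB'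
          refine ⟨LA, LB ++ [lastBlock i s], h1, by simp [h2], by simp; omega,
            fun y hy => (h4 y hy).mono (by omega) hpre, ?_⟩
          intro y hy
          rcases List.mem_append.1 hy with hy | hy
          · exact (h5 y hy).mono (by omega) hpre
          · rw [List.mem_singleton.1 hy]
            exact b1

/-- `E` is a set of auxiliary strings that splits the block of level `i` at the end of `s`
into smaller blocks, halving weights. -/
def SplitsBlock (w : Γ → ℕ) (K i : ℕ) (s : List Γ) (E : Finset (List Γ)) : Prop :=
  (∃ A e C, lastBlock i s = A ++ ([e] ++ C) ∧ 2 * wstr w A ≤ wstr w (lastBlock i s) ∧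
    2 * wstr w C ≤ wstr w (lastBlock i s) ∧
    (A = [] ∨ IsBlock K i s A ∨ A ∈ E) ∧ (C = [] ∨ IsBlock K i s C ∨ C ∈ E)) ∧
  ∀ x ∈ E, ∃ A b C, x = A ++ (b ++ C) ∧ IsBlock K i s b ∧
    2 * wstr w A ≤ wstr w x ∧ 2 * wstr w C ≤ wstr w x ∧
    (A = [] ∨ IsBlock K i s A ∨ A ∈ E) ∧ (C = [] ∨ IsBlock K i s C ∨ C ∈ E)

theorem exists_splitsBlock (w : Γ → ℕ) (K i : ℕ) {s : List Γ} (hs : s ≠ [])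
    (hi : 2 ^ i ∣ s.length + K) :
    ∃ E : Finset (List Γ), E.card ≤ i - 1 ∧ SplitsBlock w K i s E := by
  classical
  have hne : lastBlock i s ≠ [] := by
    intro h
    have h1 := congrArg List.length h
    have h2 := List.length_pos_iff.2 hs
    have h3 : 0 < 2 ^ i := by positivity
    simp only [lastBlock, List.length_drop, List.length_nil] at h1
    omega
  obtain ⟨A, e, C, h, hA, hC⟩ := List.exists_balanced_split w hne
  obtain ⟨LA, LB, rfl, rfl, h3, h4, h5⟩ := exists_blocks_around K i hs hi h
  obtain ⟨E₁, c₁, a₁, e₁⟩ := exists_split_family w LA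
  obtain ⟨E₂, c₂, a₂, e₂⟩ := exists_split_family w LB
  have up₁ : ∀ y, (y = [] ∨ y ∈ LA ∨ y ∈ E₁) → (y = [] ∨ IsBlock K i s y ∨ y ∈ E₁ ∪ E₂) := by
    rintro y (h | h | h)
    · exact Or.inl h
    · exact Or.inr (Or.inl (h4 y h))
    · exact Or.inr (Or.inr (Finset.mem_union_left _ h))
  have up₂ : ∀ y, (y = [] ∨ y ∈ LB ∨ y ∈ E₂) → (y = [] ∨ IsBlock K i s y ∨ y ∈ E₁ ∪ E₂) := by
    rintro y (h | h | h)
    · exact Or.inl h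
    · exact Or.inr (Or.inl (h5 y h))
    · exact Or.inr (Or.inr (Finset.mem_union_right _ h))
  refine ⟨E₁ ∪ E₂, ?_, ⟨LA.flatten, e, LB.flatten, h, hA, hC, up₁ _ a₁, up₂ _ a₂⟩, ?_⟩
  · have := Finset.card_union_le E₁ E₂
    omega
  · intro x hx
    rcases Finset.mem_union.1 hx with hx | hx
    · obtain ⟨A, b, C, h, hb, g1, g2, g3, g4⟩ := e₁ x hx
      exact ⟨A, b, C, h, h4 b hb, g1, g2, up₁ _ g3, up₁ _ g4⟩
    · obtain ⟨A, b, C, h, hb, g1, g2, g3, g4⟩ := e₂ x hx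
      exact ⟨A, b, C, h, h5 b hb, g1, g2, up₂ _ g3, up₂ _ g4⟩

end Blocks

section Roots

variable {Γ : Type}

/-- The alignment level of the end position of `s`, after shifting positions by `K`. -/
def level (K : ℕ) (s : List Γ) : ℕ := padicValNat 2 (s.length + K)

/-- The prefix left after removing the largest aligned block at the end of `s`. -/
def coarsen (K : ℕ) (s : List Γ) : List Γ := s.take (s.length - 2 ^ level K s)

theorem pow_dvd_iff_le_level {K i : ℕ} {s : List Γ} (hs : s ≠ []) :
    2 ^ i ∣ s.length + K ↔ i ≤ level K s := by
  have := List.length_pos_iff.2 hs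
  exact padicValNat_dvd_iff_le (by omega)

theorem coarsen_prefix_self (K : ℕ) (s : List Γ) : coarsen K s <+: s :=
  ⟨_, List.take_append_drop _ _⟩

theorem length_coarsen (K : ℕ) (s : List Γ) :
    (coarsen K s).length = s.length - 2 ^ level K s := by
  simp [coarsen]

theorem length_coarsen_lt (K : ℕ) {s : List Γ} (hs : s ≠ []) :
    (coarsen K s).length < s.length := by
  have := List.length_pos_iff.2 hs
  have h3 : 0 < 2 ^ level K s := by positivity
  rw [length_coarsen]
  omega

theorem coarsen_append_lastBlock (K : ℕ) (s : List Γ) :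
    coarsen K s ++ lastBlock (level K s) s = s :=
  List.take_append_drop _ _

theorem pow_level_succ_dvd_coarsen (K : ℕ) {s : List Γ} (h : coarsen K s ≠ []) :
    2 ^ (level K s + 1) ∣ (coarsen K s).length + K := by
  have hs : s ≠ [] := by
    rintro rfl
    simp [coarsen] at h
  have h0 := List.length_pos_iff.2 h
  obtain ⟨c, hc⟩ := (pow_dvd_iff_le_level (K := K) hs).2 le_rfl
  have hodd : ¬ 2 ∣ c := by
    rintro ⟨d, rfl⟩
    have : 2 ^ (level K s + 1) ∣ s.length + K := ⟨d, by rw [hc]; ring⟩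
    have := (pow_dvd_iff_le_level hs).1 this
    omega
  rw [length_coarsen] at h0 ⊢
  obtain ⟨d, rfl⟩ : ∃ d, c = 2 * d + 1 := ⟨c / 2, by omega⟩
  refine ⟨d, ?_⟩
  have : 2 ^ level K s * (2 * d + 1) = 2 ^ (level K s + 1) * d + 2 ^ level K s := by ring
  omega

open Classical in
/-- One refinement of a choice `f` of root prefixes. -/
noncomputable def refineRoot (w : Γ → ℕ) (K : ℕ) (f : List Γ → List Γ) (s : List Γ) : List Γ :=
  if h : s = [] then [] else
    if f s = s then s else
      if wstr w s + wstr w (f s) ≤ 2 * wstr w (refineRoot w K f (coarsen K s)) then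
        refineRoot w K f (coarsen K s) else s
termination_by s.length
decreasing_by all_goals exact length_coarsen_lt K h

/-- The prefix of `s` at which the `r`-th piece ending at `s` starts. -/
noncomputable def pieceRoot (w : Γ → ℕ) (K : ℕ) : ℕ → List Γ → List Γ
  | 0 => fun _ => []
  | r + 1 => refineRoot w K (pieceRoot w K r)

/-- The part of `s` after its `r`-th root prefix. -/
noncomputable def piece (w : Γ → ℕ) (K r : ℕ) (s : List Γ) : List Γ :=
  s.drop (pieceRoot w K r s).length

variable (w : Γ → ℕ) (K : ℕ)

theorem pieceRoot_nil (r : ℕ) : pieceRoot w K r ([] : List Γ) = [] := by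
  cases r with
  | zero => rfl
  | succ r => rw [pieceRoot, refineRoot, dif_pos rfl]

theorem pieceRoot_of_fixed {r : ℕ} {s : List Γ} (h : pieceRoot w K r s = s) :
    pieceRoot w K (r + 1) s = s := by
  by_cases hs : s = []
  · rw [hs, pieceRoot_nil]
  · rw [pieceRoot, refineRoot, dif_neg hs, if_pos h]

open Classical in
theorem pieceRoot_succ {r : ℕ} {s : List Γ} (h : pieceRoot w K r s ≠ s) :
    pieceRoot w K (r + 1) s =
      if wstr w s + wstr w (pieceRoot w K r s) ≤
          2 * wstr w (pieceRoot w K (r + 1) (coarsen K s)) then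
        pieceRoot w K (r + 1) (coarsen K s) else s := by
  have hs : s ≠ [] := by
    rintro rfl
    exact h (pieceRoot_nil w K r)
  conv_lhs => rw [pieceRoot, refineRoot, dif_neg hs, if_neg h]
  rfl

theorem pieceRoot_coarsen {r : ℕ} {s : List Γ} (h : pieceRoot w K r s ≠ s) :
    pieceRoot w K r s = pieceRoot w K r (coarsen K s) := by
  cases r with
  | zero => rfl
  | succ r =>
    have h' : pieceRoot w K r s ≠ s := fun h' => h (pieceRoot_of_fixed w K h')
    rw [pieceRoot_succ w K h'] at h ⊢
    split_ifs at h ⊢ with h1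
    · rfl
    · exact absurd rfl h

/-- Properties inherited along coarsening hold for root prefixes. -/
theorem pieceRoot_induction (r : ℕ) {P : List Γ → Prop}
    (fixed : ∀ s, pieceRoot w K r s = s → P s)
    (step : ∀ s, s ≠ [] → pieceRoot w K r s ≠ s →
      pieceRoot w K r s = pieceRoot w K r (coarsen K s) → P (coarsen K s) → P s)
    (s : List Γ) : P s := by
  induction hm : s.length using Nat.strong_induction_on generalizing s with
  | _ m ih =>
    by_cases h : pieceRoot w K r s = s
    · exact fixed s h
    · have hs : s ≠ [] := by
        rintro rfl
        exact h (pieceRoot_nil w K r)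
      exact step s hs h (pieceRoot_coarsen w K h)
        (ih _ (hm ▸ length_coarsen_lt K hs) _ rfl)

theorem pieceRoot_prefix_self (r : ℕ) (s : List Γ) : pieceRoot w K r s <+: s := by
  induction s using pieceRoot_induction w K r with
  | fixed s h => rw [h]
  | step s _ _ h ih =>
    rw [h]
    exact ih.trans (coarsen_prefix_self K s)

theorem pieceRoot_append_piece (r : ℕ) (s : List Γ) :
    pieceRoot w K r s ++ piece w K r s = s := by
  exact (List.prefix_iff_eq_append.1 (pieceRoot_prefix_self w K r s))

theorem wstr_piece (r : ℕ) (s : List Γ) :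
    wstr w (pieceRoot w K r s) + wstr w (piece w K r s) = wstr w s := by
  rw [← wstr_append, pieceRoot_append_piece]

theorem pieceRoot_keep {r : ℕ} {s : List Γ} (h : pieceRoot w K (r + 1) s ≠ s) :
    wstr w s + wstr w (pieceRoot w K r s) ≤ 2 * wstr w (pieceRoot w K (r + 1) s) := by
  have h' : pieceRoot w K r s ≠ s := fun h' => h (pieceRoot_of_fixed w K h')
  rw [pieceRoot_succ w K h'] at h ⊢
  split_ifs at h ⊢ with h1
  · exact h1
  · exact absurd rfl h

theorem pieceRoot_reset {r : ℕ} {s : List Γ} (h : pieceRoot w K (r + 1) s = s)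
    (h' : pieceRoot w K r s ≠ s) :
    2 * wstr w (pieceRoot w K (r + 1) (coarsen K s)) <
      wstr w s + wstr w (pieceRoot w K r s) := by
  have hs : s ≠ [] := by
    rintro rfl
    exact h' (pieceRoot_nil w K r)
  rw [pieceRoot_succ w K h'] at h
  split_ifs at h with h1
  · have h2 := (pieceRoot_prefix_self w K (r + 1) (coarsen K s)).length_le
    have h3 := length_coarsen_lt K hs
    rw [h] at h2
    omega
  · omega

theorem pieceRoot_pieceRoot_succ (r : ℕ) (s : List Γ) :
    pieceRoot w K r (pieceRoot w K (r + 1) s) = pieceRoot w K r s := by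
  induction s using pieceRoot_induction w K (r + 1) with
  | fixed s h => rw [h]
  | step s _ hne h ih =>
    have h' : pieceRoot w K r s ≠ s := fun h' => hne (pieceRoot_of_fixed w K h')
    rw [h, ih, ← pieceRoot_coarsen w K h']

theorem pieceRoot_idem (r : ℕ) (s : List Γ) :
    pieceRoot w K r (pieceRoot w K r s) = pieceRoot w K r s := by
  induction s using pieceRoot_induction w K r with
  | fixed s h => rw [h, h]
  | step s _ _ h ih => rw [h, ih]

theorem dvd_coarsen {i : ℕ} {s : List Γ} (hi : 2 ^ i ∣ s.length + K) (hc : coarsen K s ≠ []) :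
    2 ^ i ∣ (coarsen K s).length + K := by
  have hs : s ≠ [] := by
    rintro rfl
    simp [coarsen] at hc
  have := (pow_dvd_iff_le_level hs).1 hi
  exact (pow_dvd_pow 2 (by omega)).trans (pow_level_succ_dvd_coarsen K hc)

theorem dvd_pieceRoot {i : ℕ} (r : ℕ) {s : List Γ} (hi : 2 ^ i ∣ s.length + K)
    (h0 : pieceRoot w K r s ≠ []) : 2 ^ i ∣ (pieceRoot w K r s).length + K := by
  induction s using pieceRoot_induction w K r with
  | fixed s h => rwa [h]
  | step s _ _ h ih =>
    rw [h] at h0 ⊢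
    refine ih (dvd_coarsen K hi ?_) h0
    intro hc
    rw [hc, pieceRoot_nil] at h0
    exact h0 rfl

theorem pieceRoot_succ_ne {w : Γ → ℕ} (hw : ∀ a, 0 < w a) {r : ℕ} {s : List Γ}
    (h : pieceRoot w K r s ≠ s) : pieceRoot w K (r + 1) s ≠ pieceRoot w K r s := by
  intro h'
  have h1 := pieceRoot_keep w K (h' ▸ h)
  have h2 := wstr_piece w K r s
  have h3 : 0 < wstr w (piece w K r s) := by
    apply wstr_pos hw
    intro h0
    have := pieceRoot_append_piece w K r s
    rw [h0, List.append_nil] at this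
    exact h this
  rw [h'] at h1
  omega

end Roots

section Family

variable {Γ : Type}

/-- `F` contains the pieces, blocks and auxiliary strings of all strings in `Q`. -/
structure ContainsPieces (w : Γ → ℕ) (K : ℕ) (E : List Γ → ℕ → Finset (List Γ))
    (Q F : Set (List Γ)) : Prop where
  prefix_closed : ∀ s ∈ Q, ∀ t, t <+: s → t ∈ Q
  card_le : ∀ s i, s ≠ [] → 2 ^ i ∣ s.length + K → (E s i).card ≤ i - 1
  splits : ∀ s i, s ≠ [] → 2 ^ i ∣ s.length + K → SplitsBlock w K i s (E s i)
  piece_mem : ∀ s ∈ Q, s ≠ [] → ∀ r, 2 ^ r ∣ s.length + K → piece w K r s ∈ F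
  block_mem : ∀ s ∈ Q, s ≠ [] → ∀ i, 1 ≤ i → 2 ^ i ∣ s.length + K → lastBlock i s ∈ F
  aux_mem : ∀ s ∈ Q, s ≠ [] → ∀ i, 1 ≤ i → 2 ^ i ∣ s.length + K → ∀ x ∈ E s i, x ∈ F

namespace ContainsPieces

variable {w : Γ → ℕ} {K : ℕ} {E : List Γ → ℕ → Finset (List Γ)} {Q F : Set (List Γ)}
  {s x : List Γ} {i r : ℕ}

theorem piece_small (h : ContainsPieces w K E Q F) (hs : s ∈ Q)
    (hr : s ≠ [] → 2 ^ r ∣ s.length + K) :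
    (piece w K r s).length ≤ 1 ∨ piece w K r s ∈ F := by
  by_cases h0 : s = []
  · left
    simp [h0, piece]
  · exact Or.inr (h.piece_mem s hs h0 r (hr h0))

theorem lastBlock_small (h : ContainsPieces w K E Q F) (hs : s ∈ Q) (h0 : s ≠ [])
    (hi : 2 ^ i ∣ s.length + K) : (lastBlock i s).length ≤ 1 ∨ lastBlock i s ∈ F := by
  rcases Nat.eq_zero_or_pos i with rfl | hi'
  · exact Or.inl (length_lastBlock_zero s)
  · exact Or.inr (h.block_mem s hs h0 i hi' hi)

theorem isBlock_small (h : ContainsPieces w K E Q F) (hs : s ∈ Q) (hx : IsBlock K i s x) :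
    x.length ≤ 1 ∨ x ∈ F := by
  obtain ⟨s', i', h1, h2, _, h4, rfl⟩ := hx
  exact h.lastBlock_small (h.prefix_closed s hs s' h2) h1 h4

theorem split_small (h : ContainsPieces w K E Q F) (hs : s ∈ Q) (h0 : s ≠ [])
    (hi : 2 ^ i ∣ s.length + K) (hx : x = [] ∨ IsBlock K i s x ∨ x ∈ E s i) :
    x.length ≤ 1 ∨ x ∈ F := by
  rcases hx with rfl | hx | hx
  · simp
  · exact h.isBlock_small hs hx
  · rcases Nat.eq_zero_or_pos i with rfl | hi'
    · have := h.card_le s 0 h0 hi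
      rw [Finset.card_eq_zero.1 (Nat.le_zero.1 this)] at hx
      simp at hx
    · exact Or.inr (h.aux_mem s hs h0 i hi' hi x hx)

theorem dec_lastBlock (h : ContainsPieces w K E Q F) (hs : s ∈ Q) (h0 : s ≠ [])
    (hi : 2 ^ i ∣ s.length + K) : Dec w F 3 (wstr w (lastBlock i s)) (lastBlock i s) := by
  obtain ⟨⟨A, e, C, hx, hA, hC, hA', hC'⟩, _⟩ := h.splits s i h0 hi
  generalize wstr w (lastBlock i s) = W at hA hC ⊢
  rw [hx]
  exact (Dec.single (h.split_small hs h0 hi hA') hA).append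
    ((Dec.letter e).append (Dec.single (h.split_small hs h0 hi hC') hC))

theorem dec_isBlock (h : ContainsPieces w K E Q F) (hs : s ∈ Q) (hx : IsBlock K i s x) :
    Dec w F 3 (wstr w x) x := by
  obtain ⟨s', i', h1, h2, _, h4, rfl⟩ := hx
  exact h.dec_lastBlock (h.prefix_closed s hs s' h2) h1 h4

theorem dec_aux (h : ContainsPieces w K E Q F) (hs : s ∈ Q) (h0 : s ≠ [])
    (hi : 2 ^ i ∣ s.length + K) (hx : x ∈ E s i) : Dec w F 5 (wstr w x) x := by
  obtain ⟨_, hE⟩ := h.splits s i h0 hi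
  obtain ⟨A, b, C, hx, hb, hA, hC, hA', hC'⟩ := hE x hx
  have hbx : wstr w b ≤ wstr w x := by
    rw [hx, wstr_append, wstr_append]
    omega
  generalize wstr w x = W at hA hC hbx ⊢
  rw [hx]
  exact (Dec.single (h.split_small hs h0 hi hA') hA).append
    (((h.dec_isBlock hs hb).mono le_rfl hbx).append
      (Dec.single (h.split_small hs h0 hi hC') hC))

theorem coarsen_mem (h : ContainsPieces w K E Q F) (hs : s ∈ Q) : coarsen K s ∈ Q :=
  h.prefix_closed s hs _ (coarsen_prefix_self K s)

theorem dec_piece_of_dvd (hw : ∀ a, 0 < w a) (h : ContainsPieces w K E Q F) (hs : s ∈ Q)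
    (hr : 2 ^ (r + 1) ∣ s.length + K) (hne : pieceRoot w K r s ≠ s) :
    Dec w F 5 (wstr w (piece w K r s)) (piece w K r s) := by
  set a := pieceRoot w K r s with ha
  set s' := pieceRoot w K (r + 1) s with hs'
  set p := coarsen K s' with hp
  set t := pieceRoot w K (r + 1) p with ht
  have s'_mem : s' ∈ Q := h.prefix_closed s hs s' (pieceRoot_prefix_self w K (r + 1) s)
  have p_mem : p ∈ Q := h.coarsen_mem s'_mem
  have t_mem : t ∈ Q := h.prefix_closed p p_mem t (pieceRoot_prefix_self w K (r + 1) p)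
  have hs'a : s' ≠ a := pieceRoot_succ_ne K hw hne
  have hrs' : pieceRoot w K r s' = a := pieceRoot_pieceRoot_succ w K r s
  have hfix : pieceRoot w K (r + 1) s' = s' := pieceRoot_idem w K (r + 1) s
  have hne' : pieceRoot w K r s' ≠ s' := fun h' => hs'a (h'.symm.trans hrs')
  have s'_ne : s' ≠ [] := by
    intro h'
    rw [h'] at hne'
    exact hne' (pieceRoot_nil w K r)
  have hs'dvd : 2 ^ (r + 1) ∣ s'.length + K := dvd_pieceRoot w K (r + 1) hr s'_ne
  have hpdvd : p ≠ [] → 2 ^ (r + 1) ∣ p.length + K := dvd_coarsen K hs'dvd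
  have hrp : pieceRoot w K r p = a := (pieceRoot_coarsen w K hne').symm.trans hrs'
  have hrt : pieceRoot w K r t = a := (pieceRoot_pieceRoot_succ w K r p).trans hrp
  have htdvd : t ≠ [] → 2 ^ r ∣ t.length + K := by
    intro h'
    have hpne : p ≠ [] := by
      rintro h''
      rw [ht, h'', pieceRoot_nil] at h'
      exact h' rfl
    exact (pow_dvd_pow 2 (Nat.le_succ r)).trans
      (dvd_pieceRoot w K (r + 1) (hpdvd hpne) h')
  have hreset : 2 * wstr w t < wstr w s' + wstr w a := by
    have := pieceRoot_reset w K hfix hne'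
    rwa [hrs'] at this
  have eq_s := pieceRoot_append_piece w K r s
  have eq_s₁ := pieceRoot_append_piece w K (r + 1) s
  have eq_p := pieceRoot_append_piece w K r p
  have eq_p₁ := pieceRoot_append_piece w K (r + 1) p
  have eq_t := pieceRoot_append_piece w K r t
  have eq_s' := coarsen_append_lastBlock K s'
  rw [← ha] at eq_s
  rw [← hs'] at eq_s₁
  rw [hrp] at eq_p
  rw [← ht] at eq_p₁
  rw [hrt] at eq_t
  rw [← hp] at eq_s'
  have w_s := congrArg (wstr w) eq_s
  have w_s₁ := congrArg (wstr w) eq_s₁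
  have w_p := congrArg (wstr w) eq_p
  have w_p₁ := congrArg (wstr w) eq_p₁
  have w_t := congrArg (wstr w) eq_t
  have w_s' := congrArg (wstr w) eq_s'
  simp only [wstr_append] at w_s w_s₁ w_p w_p₁ w_t w_s'
  have hlast : 2 * wstr w (piece w K (r + 1) s) ≤ wstr w (piece w K r s) := by
    by_cases hk : s' = s
    · rw [hk] at w_s₁
      omega
    · have := pieceRoot_keep w K hk
      rw [← ha, ← hs'] at this
      omega
  have dlast := Dec.single (h.piece_small hs fun _ => hr) hlast
  by_cases hZ : 2 * wstr w (lastBlock (level K s') s') ≤ wstr w (piece w K r s)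
  · have hmid : 2 * wstr w (piece w K (r + 1) p) ≤ wstr w (piece w K r s) := by
      by_cases hk : t = p
      · rw [hk] at w_p₁
        omega
      · have := pieceRoot_keep w K hk
        rw [hrp, ← ht] at this
        omega
    have d1 := Dec.single (h.piece_small t_mem htdvd)
      (show 2 * wstr w (piece w K r t) ≤ wstr w (piece w K r s) by omega)
    have d2 := Dec.single (h.piece_small p_mem hpdvd) hmid
    have d3 := Dec.single (h.lastBlock_small s'_mem s'_ne
      ((pow_dvd_iff_le_level s'_ne).2 le_rfl)) hZ
    have heq : piece w K r t ++ (piece w K (r + 1) p ++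
        (lastBlock (level K s') s' ++ piece w K (r + 1) s)) = piece w K r s := by
      apply List.append_cancel_left (as := a)
      rw [eq_s, ← List.append_assoc, eq_t, ← List.append_assoc, eq_p₁, ← List.append_assoc,
        eq_s', eq_s₁]
    have := d1.append (d2.append (d3.append dlast))
    rw [heq] at this
    exact this.mono (by norm_num) le_rfl
  · have d1 := Dec.single (h.piece_small p_mem fun h' =>
        (pow_dvd_pow 2 (Nat.le_succ r)).trans (hpdvd h'))
      (show 2 * wstr w (piece w K r p) ≤ wstr w (piece w K r s) by omega)
    have d2 := (h.dec_lastBlock s'_mem s'_ne ((pow_dvd_iff_le_level s'_ne).2 le_rfl)).mono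
      le_rfl (show _ ≤ wstr w (piece w K r s) by omega)
    have heq : piece w K r p ++ (lastBlock (level K s') s' ++ piece w K (r + 1) s) =
        piece w K r s := by
      apply List.append_cancel_left (as := a)
      rw [eq_s, ← List.append_assoc, eq_p, ← List.append_assoc, eq_s', eq_s₁]
    have := d1.append (d2.append dlast)
    rwa [heq] at this

theorem dec_piece (hw : ∀ a, 0 < w a) (h : ContainsPieces w K E Q F) (hs : s ∈ Q)
    (h0 : s ≠ []) (hr : 2 ^ r ∣ s.length + K) :
    Dec w F 6 (wstr w (piece w K r s)) (piece w K r s) := by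
  by_cases hne : pieceRoot w K r s = s
  · have : piece w K r s = [] := by simp [piece, hne]
    rw [this]
    exact ⟨[], by simp, rfl, by simp⟩
  by_cases hr' : 2 ^ (r + 1) ∣ s.length + K
  · exact (h.dec_piece_of_dvd hw hs hr' hne).mono (by norm_num) le_rfl
  have hlev : level K s = r := by
    have h1 := (pow_dvd_iff_le_level h0).1 hr
    have h2 : ¬ r + 1 ≤ level K s := fun h' => hr' ((pow_dvd_iff_le_level h0).2 h')
    omega
  have p_mem := h.coarsen_mem hs
  have hpdvd : coarsen K s ≠ [] → 2 ^ (r + 1) ∣ (coarsen K s).length + K := fun h' =>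
    hlev ▸ pow_level_succ_dvd_coarsen K h'
  have hrp := pieceRoot_coarsen w K hne
  have eq_s := pieceRoot_append_piece w K r s
  have eq_p := pieceRoot_append_piece w K r (coarsen K s)
  have eq_c := coarsen_append_lastBlock K s
  rw [← hrp] at eq_p
  rw [hlev] at eq_c
  have heq : piece w K r (coarsen K s) ++ lastBlock r s = piece w K r s := by
    apply List.append_cancel_left (as := pieceRoot w K r s)
    rw [eq_s, ← List.append_assoc, eq_p, eq_c]
  have hweq := congrArg (wstr w) heq
  rw [wstr_append] at hweq
  have dtriple := h.dec_lastBlock hs h0 hr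
  by_cases hp : pieceRoot w K r (coarsen K s) = coarsen K s
  · have : piece w K r (coarsen K s) = [] := by simp [piece, hp]
    rw [this, List.nil_append] at heq
    rw [← heq]
    exact dtriple.mono (by norm_num) le_rfl
  by_cases hZ : 2 * wstr w (lastBlock r s) ≤ wstr w (piece w K r s)
  · have hpne : coarsen K s ≠ [] := by
      intro h'
      rw [h'] at hp
      exact hp (pieceRoot_nil w K r)
    have d1 := (h.dec_piece_of_dvd hw p_mem (hpdvd hpne) hp).mono le_rfl
      (show _ ≤ wstr w (piece w K r s) by omega)
    have := d1.append (Dec.single (h.lastBlock_small hs h0 hr) hZ)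
    rwa [heq] at this
  · have d1 := Dec.single (h.piece_small p_mem fun h' =>
        (pow_dvd_pow 2 (Nat.le_succ r)).trans (hpdvd h'))
      (show 2 * wstr w (piece w K r (coarsen K s)) ≤ wstr w (piece w K r s) by omega)
    have := d1.append (dtriple.mono le_rfl (show _ ≤ wstr w (piece w K r s) by omega))
    rw [heq] at this
    exact this.mono (by norm_num) le_rfl

end ContainsPieces

end Family

section Counting

variable {Γ : Type}

open Classical in
/-- The pieces, blocks and auxiliary strings associated with a string. -/
noncomputable def pieceFamily (w : Γ → ℕ) (K : ℕ) (E : List Γ → ℕ → Finset (List Γ))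
    (s : List Γ) : Finset (List Γ) :=
  (Finset.range (level K s + 1)).image (fun r => piece w K r s) ∪
    (Finset.range (level K s)).biUnion fun i => insert (lastBlock (i + 1) s) (E s (i + 1))

theorem mem_pieceFamily {w : Γ → ℕ} {K : ℕ} {E : List Γ → ℕ → Finset (List Γ)}
    {s x : List Γ} : x ∈ pieceFamily w K E s ↔ (∃ r ≤ level K s, piece w K r s = x) ∨
      ∃ i, 1 ≤ i ∧ i ≤ level K s ∧ (x = lastBlock i s ∨ x ∈ E s i) := by
  simp only [pieceFamily, Finset.mem_union, Finset.mem_image, Finset.mem_range, Nat.lt_succ_iff,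
    Finset.mem_biUnion, Finset.mem_insert]
  refine or_congr Iff.rfl ⟨?_, ?_⟩
  · rintro ⟨i, hi, h⟩
    exact ⟨i + 1, by omega, hi, h⟩
  · rintro ⟨i, h1, hi, h⟩
    obtain ⟨j, rfl⟩ := Nat.exists_eq_add_of_le' h1
    exact ⟨j, hi, h⟩

theorem card_pieceFamily_le (w : Γ → ℕ) {K : ℕ} {E : List Γ → ℕ → Finset (List Γ)}
    {s : List Γ} (hE : ∀ i, s ≠ [] → 2 ^ i ∣ s.length + K → (E s i).card ≤ i - 1)
    (hs : s ≠ []) :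
    (pieceFamily w K E s).card ≤ 1 + ∑ i ∈ Finset.range (level K s), (i + 2) := by
  classical
  have h1 : ((Finset.range (level K s + 1)).image fun r => piece w K r s).card ≤
      level K s + 1 := Finset.card_image_le.trans (by simp)
  have h2 : ((Finset.range (level K s)).biUnion
      fun i => insert (lastBlock (i + 1) s) (E s (i + 1))).card ≤
      ∑ i ∈ Finset.range (level K s), (i + 1) := by
    refine Finset.card_biUnion_le.trans (Finset.sum_le_sum fun i hi => ?_)
    have := hE (i + 1) hs ((pow_dvd_iff_le_level hs).2 (Finset.mem_range.1 hi))
    have := Finset.card_insert_le (lastBlock (i + 1) s) (E s (i + 1))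
    omega
  have h3 : ∑ i ∈ Finset.range (level K s), (i + 2) =
      ∑ i ∈ Finset.range (level K s), (i + 1) + level K s := by
    simp only [show ∀ i, i + 2 = i + 1 + 1 from fun _ => rfl]
    rw [Finset.sum_add_distrib (g := fun _ => 1)]
    simp
  refine (Finset.card_union_le _ _).trans ?_
  omega

/-- Some shift makes aligned positions at most as frequent as on average, at all levels. -/
theorem exists_shift {ν : Type} (S : Finset ν) (d : ν → ℕ) (R : ℕ) :
    ∃ K, ∀ r ≤ R, 2 ^ r * (S.filter fun v => 2 ^ r ∣ d v + K).card ≤ S.card := by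
  classical
  induction R with
  | zero => exact ⟨0, fun r hr => by simp [Nat.le_zero.1 hr]⟩
  | succ R ih =>
    obtain ⟨K, hK⟩ := ih
    have hshift : ∀ r ≤ R, 2 ^ r *
        (S.filter fun v => 2 ^ r ∣ d v + (K + 2 ^ R)).card ≤ S.card := by
      intro r hr
      simp only [← add_assoc, Nat.dvd_add_left (pow_dvd_pow 2 hr)]
      exact hK r hr
    have hdisj : Disjoint (S.filter fun v => 2 ^ (R + 1) ∣ d v + K)
        (S.filter fun v => 2 ^ (R + 1) ∣ d v + (K + 2 ^ R)) := by
      refine Finset.disjoint_filter.2 fun v _ h1 h2 => ?_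
      rw [← add_assoc, Nat.dvd_add_right h1] at h2
      have := Nat.le_of_dvd (by positivity) h2
      have h3 : 0 < 2 ^ R := by positivity
      rw [pow_succ] at this
      omega
    have hsub : (S.filter fun v => 2 ^ (R + 1) ∣ d v + K) ∪
        (S.filter fun v => 2 ^ (R + 1) ∣ d v + (K + 2 ^ R)) ⊆
        S.filter fun v => 2 ^ R ∣ d v + K := by
      intro v hv
      have hR : 2 ^ R ∣ 2 ^ (R + 1) := pow_dvd_pow 2 (Nat.le_succ R)
      rcases Finset.mem_union.1 hv with hv | hv <;> obtain ⟨h1, h2⟩ := Finset.mem_filter.1 hv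
      · exact Finset.mem_filter.2 ⟨h1, hR.trans h2⟩
      · have := hR.trans h2
        rw [← add_assoc, Nat.dvd_add_left (dvd_refl _)] at this
        exact Finset.mem_filter.2 ⟨h1, this⟩
    have hcard := Finset.card_le_card hsub
    rw [Finset.card_union_of_disjoint hdisj] at hcard
    have hR := hK R le_rfl
    set a := (S.filter fun v => 2 ^ (R + 1) ∣ d v + K).card with ha
    set b := (S.filter fun v => 2 ^ (R + 1) ∣ d v + (K + 2 ^ R)).card with hb
    have hab := (Nat.mul_le_mul_left (2 ^ R) hcard).trans hR
    rcases le_total a b with hle | hle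
    · refine ⟨K, fun r hr => ?_⟩
      rcases Nat.le_succ_iff.1 hr with hr | rfl
      · exact hK r hr
      · refine le_trans ?_ hab
        rw [← ha, pow_succ, mul_assoc]
        exact Nat.mul_le_mul_left _ (by omega)
    · refine ⟨K + 2 ^ R, fun r hr => ?_⟩
      rcases Nat.le_succ_iff.1 hr with hr | rfl
      · exact hshift r hr
      · refine le_trans ?_ hab
        rw [← hb, pow_succ, mul_assoc]
        exact Nat.mul_le_mul_left _ (by omega)

theorem sum_level_le (n : ℕ) (m : ℕ → ℕ) (R : ℕ) (h : ∀ i < R, 2 ^ (i + 1) * m i ≤ n) :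
    ∑ i ∈ Finset.range R, (i + 2) * m i ≤ 3 * n := by
  have key : 2 ^ R * ∑ i ∈ Finset.range R, (i + 2) * m i + (R + 3) * n ≤ 2 ^ R * (3 * n) := by
    induction R with
    | zero => simp
    | succ R ih =>
      have h1 := ih fun i hi => h i (by omega)
      have h2 := Nat.mul_le_mul_left (R + 2) (h R (by omega))
      rw [Finset.sum_range_succ]
      calc _ = 2 * (2 ^ R * ∑ i ∈ Finset.range R, (i + 2) * m i + (R + 3) * n) +
            (R + 2) * (2 ^ (R + 1) * m R) - (R + 2) * n := by
            symm
            apply Nat.sub_eq_of_eq_add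
            ring
        _ ≤ _ := by
            rw [pow_succ]
            rw [pow_succ] at h2
            have : 2 ^ R * 2 * (3 * n) = 2 * (2 ^ R * (3 * n)) := by ring
            omega
  exact Nat.le_of_mul_le_mul_left ((Nat.le_add_right _ _).trans key) (by positivity)

end Counting

namespace LTree

variable {ν Γ : Type} (T : LTree ν Γ)

theorem prefixAt_root : T.prefixAt T.root = [] := by
  rw [prefixAt]
  split
  · rfl
  · next u h => simp [(T.parent_eq_none T.root).2 rfl] at h

theorem exists_parent {v : ν} (hv : v ≠ T.root) :
    ∃ u, T.depth u < T.depth v ∧ T.prefixAt v = T.prefixAt u ++ T.label v := by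
  obtain ⟨u, hu⟩ := Option.ne_none_iff_exists'.1 (mt (T.parent_eq_none v).1 hv)
  refine ⟨u, T.depth_lt v u hu, ?_⟩
  rw [prefixAt]
  split
  · next h => simp [hu] at h
  · next u' h =>
    obtain rfl : u = u' := by simpa [hu] using h
    rfl

theorem prefixAt_ne_nil (hlab : ∀ v, v ≠ T.root → (T.label v).length = 1) {v : ν}
    (hv : v ≠ T.root) : T.prefixAt v ≠ [] := by
  obtain ⟨u, _, hu⟩ := T.exists_parent hv
  intro h
  have := hlab v hv
  simp_all

theorem exists_prefixAt_eq (hlab : ∀ v, v ≠ T.root → (T.label v).length = 1) (v : ν)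
    {t : List Γ} (ht : t <+: T.prefixAt v) : ∃ u, T.prefixAt u = t := by
  induction hm : T.depth v using Nat.strong_induction_on generalizing v with
  | _ m ih =>
    by_cases hv : v = T.root
    · rw [hv, prefixAt_root, List.prefix_nil] at ht
      exact ⟨T.root, by rw [prefixAt_root, ht]⟩
    · obtain ⟨u, hlt, hu⟩ := T.exists_parent hv
      obtain ⟨a, ha⟩ := List.length_eq_one_iff.1 (hlab v hv)
      rw [hu, ha] at ht
      rcases List.prefix_concat_iff.1 ht with h | h
      · exact ⟨v, by rw [hu, ha, h]⟩
      · exact ih _ (hm ▸ hlt) u h rfl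

end LTree

/-- For every labeled tree `T` with `n ≥ 1` edges, each edge
labeled by a single symbol of a weighted alphabet `Γ`, there is an SLP `G` over `Γ`
defining all nonempty prefixes in `T` such that (a) `G` has at most `4n` variables
and right-hand sides of length at most `6`, and (b) the subgraph of `dag(G)` induced
by the heavy symbols is a disjoint union of paths: counting multiplicities, every
heavy symbol has at most one outgoing edge to a heavy symbol and at most one
incoming edge from a heavy variable (the absence of cycles is automatic since
right-hand side variables have strictly smaller rank). -/
theorem tree_prefix_slp_heavy_paths :
    ∀ (Γ ν : Type) (instΓ : Fintype Γ) (instν : Fintype ν)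
      (w : Γ → ℕ), (∀ a : Γ, 0 < w a) →
      ∀ (T : LTree ν Γ) (n : ℕ), 1 ≤ n →
        Fintype.card ν = n + 1 →
        (∀ v : ν, v ≠ T.root → (T.label v).length = 1) →
        ∃ (V : Type) (instV : Fintype V) (G : SLP V Γ),
          (∀ v : ν, T.prefixAt v ≠ [] → G.defines (T.prefixAt v)) ∧
          Fintype.card V ≤ 4 * n ∧
          (∀ A : V, (G.rhs A).length ≤ 6) ∧
          -- out-degree ≤ 1: no rule of a heavy variable contains two occurrences
          -- of heavy symbols on its right-hand side
          (∀ A : V, G.HeavySym w (Sum.inl A) →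
            ∀ (u v t : List (V ⊕ Γ)) (β γ : V ⊕ Γ),
              G.rhs A = u ++ β :: v ++ γ :: t →
              G.HeavySym w β → G.HeavySym w γ → False) ∧
          -- in-degree ≤ 1: a heavy symbol occurs on the right-hand side of at most
          -- one heavy variable
          (∀ β : V ⊕ Γ, G.HeavySym w β →
            ∀ A A' : V, G.HeavySym w (Sum.inl A) → G.HeavySym w (Sum.inl A') →
              β ∈ G.rhs A → β ∈ G.rhs A' → A = A') := by
  intro Γ ν _ _ w hw T n hn hcard hlab
  classical
  set S : Finset ν := Finset.univ.filter (· ≠ T.root) with hS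
  have hSn : S.card = n := by
    rw [hS, Finset.filter_ne', Finset.card_erase_of_mem (Finset.mem_univ _), Finset.card_univ,
      hcard, Nat.add_sub_cancel]
  have hmemS : ∀ v, v ∈ S ↔ v ≠ T.root := fun v => by simp [hS]
  obtain ⟨K, hK⟩ := exists_shift S (fun v => (T.prefixAt v).length) n
  rw [hSn] at hK
  choose! E hEcard hEsplit using fun (s : List Γ) (i : ℕ) (hs : s ≠ [])
    (hi : 2 ^ i ∣ s.length + K) => exists_splitsBlock w K i hs hi
  have hne : ∀ v ∈ S, T.prefixAt v ≠ [] := fun v hv =>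
    T.prefixAt_ne_nil hlab ((hmemS v).1 hv)
  set F : Finset (List Γ) := S.biUnion fun v => pieceFamily w K E (T.prefixAt v) with hF
  have hmemF : ∀ v, T.prefixAt v ≠ [] → ∀ x ∈ pieceFamily w K E (T.prefixAt v), x ∈ F := by
    intro v hv x hx
    refine Finset.mem_biUnion.2 ⟨v, (hmemS v).2 ?_, hx⟩
    rintro rfl
    exact hv T.prefixAt_root
  have hC : ContainsPieces w K E (Set.range T.prefixAt) (F : Set (List Γ)) := by
    refine ⟨?_, hEcard, hEsplit, ?_, ?_, ?_⟩
    · rintro _ ⟨v, rfl⟩ t ht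
      exact T.exists_prefixAt_eq hlab v ht
    · rintro _ ⟨v, rfl⟩ hv r hr
      exact hmemF v hv _ (mem_pieceFamily.2 (Or.inl ⟨r, (pow_dvd_iff_le_level hv).1 hr, rfl⟩))
    · rintro _ ⟨v, rfl⟩ hv i hi hr
      exact hmemF v hv _ (mem_pieceFamily.2
        (Or.inr ⟨i, hi, (pow_dvd_iff_le_level hv).1 hr, Or.inl rfl⟩))
    · rintro _ ⟨v, rfl⟩ hv i hi hr x hx
      exact hmemF v hv _ (mem_pieceFamily.2
        (Or.inr ⟨i, hi, (pow_dvd_iff_le_level hv).1 hr, Or.inr hx⟩))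
  have hdec : ∀ x ∈ F, Dec w (F : Set (List Γ)) 6 (wstr w x) x := by
    intro x hx
    obtain ⟨v, hv, hx⟩ := Finset.mem_biUnion.1 hx
    have hv := hne v hv
    rcases mem_pieceFamily.1 hx with ⟨r, hr, rfl⟩ | ⟨i, _, hi, rfl | hx⟩
    · exact hC.dec_piece hw ⟨v, rfl⟩ hv ((pow_dvd_iff_le_level hv).2 hr)
    · exact (hC.dec_lastBlock ⟨v, rfl⟩ hv ((pow_dvd_iff_le_level hv).2 hi)).mono
        (by norm_num) le_rfl
    · exact (hC.dec_aux ⟨v, rfl⟩ hv ((pow_dvd_iff_le_level hv).2 hi) hx).mono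
        (by norm_num) le_rfl
  have hdef : ∀ v, T.prefixAt v ≠ [] → T.prefixAt v ∈ F := fun v hv =>
    hmemF v hv _ (mem_pieceFamily.2 (Or.inl ⟨0, Nat.zero_le _, rfl⟩))
  have hFcard : F.card ≤ 4 * n := by
    have hlevel : ∀ v ∈ S, level K (T.prefixAt v) ≤ n := by
      intro v hv
      by_contra hlt
      have h1 := hK n le_rfl
      have h2 : 0 < (S.filter fun v => 2 ^ n ∣ (T.prefixAt v).length + K).card :=
        Finset.card_pos.2 ⟨v, Finset.mem_filter.2
          ⟨hv, (pow_dvd_iff_le_level (hne v hv)).2 (by omega)⟩⟩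
      have h3 : n < 2 ^ n := Nat.lt_two_pow_self
      have := Nat.le_mul_of_pos_right (2 ^ n) h2
      omega
    calc F.card ≤ ∑ v ∈ S, (pieceFamily w K E (T.prefixAt v)).card := Finset.card_biUnion_le
      _ ≤ ∑ v ∈ S, (1 + ∑ i ∈ (Finset.range n).filter
            (fun i => 2 ^ (i + 1) ∣ (T.prefixAt v).length + K), (i + 2)) := by
        refine Finset.sum_le_sum fun v hv => ?_
        refine (card_pieceFamily_le w (hEcard _) (hne v hv)).trans ?_
        refine Nat.add_le_add_left (Finset.sum_le_sum_of_subset fun i hi => ?_) 1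
        rw [Finset.mem_range] at hi
        have := hlevel v hv
        exact Finset.mem_filter.2 ⟨Finset.mem_range.2 (by omega),
          (pow_dvd_iff_le_level (hne v hv)).2 hi⟩
      _ = n + ∑ i ∈ Finset.range n,
            (i + 2) * (S.filter fun v => 2 ^ (i + 1) ∣ (T.prefixAt v).length + K).card := by
        rw [Finset.sum_add_distrib, Finset.sum_const, hSn, smul_eq_mul, mul_one]
        simp only [Finset.sum_filter]
        rw [Finset.sum_comm]
        congr 1
        refine Finset.sum_congr rfl fun i _ => ?_
        rw [← Finset.sum_filter, Finset.sum_const, smul_eq_mul, mul_comm]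
      _ ≤ n + 3 * n := by
        refine Nat.add_le_add_left (sum_level_le n _ n fun i hi => hK (i + 1) hi) n
      _ = 4 * n := by ring
  have hFne : F.Nonempty := by
    obtain ⟨v, hv⟩ := Finset.card_pos.1 (show 0 < S.card by omega)
    exact ⟨_, hdef v (hne v hv)⟩
  obtain ⟨G, hval, hlen, hcon⟩ := exists_contracting_slp hw F hFne hdec
  refine ⟨{x // x ∈ F}, inferInstance, G, fun v hv => ⟨⟨_, hdef v hv⟩, hval _⟩, ?_, hlen, ?_, ?_⟩
  · simpa using hFcard
  · intro A hA
    exact absurd hA (hcon.not_heavySym A)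
  · intro β _ A _ hA
    exact absurd hA (hcon.not_heavySym A)
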